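/- arXiv:1610.06246 — 2 statements merged into one kernel-verified Lean document; each statement's English description precedes it below -/
import Mathlib

section
/- There exists a unique family (b_x)_{x ∈ W} of elements of the Hecke algebra H such that for every x ∈ W: d(b_x) = b_x, and b_x − h_x lies in Σ_{y < x} v ℤ[v] h_y. Moreover this family is a basis of H as a ℤ[v,v⁻¹]-module. -/
open LaurentPolynomial

/-- The Bruhat order on a Coxeter group: `y ≤ x` iff some reduced expression for `x`
admits a subword that is a reduced expression for `y`. -/
def bruhatLE {B W : Type} [Group W] {M : CoxeterMatrix B} (cs : CoxeterSystem M W)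
    (y x : W) : Prop :=
  ∃ ω : List B, cs.IsReduced ω ∧ cs.wordProd ω = x ∧
    ∃ ω' : List B, ω'.Sublist ω ∧ cs.IsReduced ω' ∧ cs.wordProd ω' = y

/-- The strict Bruhat order. -/
def bruhatLT {B W : Type} [Group W] {M : CoxeterMatrix B} (cs : CoxeterSystem M W)
    (y x : W) : Prop :=
  bruhatLE cs y x ∧ y ≠ x

/-- `H`, a `ℤ[v,v⁻¹]`-algebra with basis `h = (h_x)_{x ∈ W}`, is the Hecke algebra of the
Coxeter system `cs`: the unit is `h_e` and multiplication satisfies the usual rules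
`h_s h_x = h_{sx}` if `ℓ(sx) > ℓ(x)` and `h_s h_x = (v⁻¹ - v) h_x + h_{sx}` if
`ℓ(sx) < ℓ(x)`.  Here `v := T 1` is the Laurent variable. -/
def IsHeckeAlgebra {B W : Type} [Group W] {M : CoxeterMatrix B} (cs : CoxeterSystem M W)
    {H : Type} [Ring H] [Algebra (LaurentPolynomial ℤ) H]
    (h : Module.Basis W (LaurentPolynomial ℤ) H) : Prop :=
  h 1 = 1 ∧
  ∀ (i : B) (x : W),
    (cs.length (cs.simple i * x) > cs.length x →
      h (cs.simple i) * h x = h (cs.simple i * x)) ∧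
    (cs.length (cs.simple i * x) < cs.length x →
      h (cs.simple i) * h x = (T (-1) - T 1 : LaurentPolynomial ℤ) • h x + h (cs.simple i * x))

/-- `d : H → H` is the bar involution: a ring homomorphism with `d(vⁿ a) = v⁻ⁿ d(a)` and
`d(h_x) = (h_{x⁻¹})⁻¹`. -/
def IsBarInvolution {W H : Type} [Group W] [Ring H] [Algebra (LaurentPolynomial ℤ) H]
    (h : W → H) (d : H →+* H) : Prop :=
  (∀ (n : ℤ) (a : H), d ((T n : LaurentPolynomial ℤ) • a) = (T (-n) : LaurentPolynomial ℤ) • d a) ∧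
  ∀ x : W, d (h x) = Ring.inverse (h x⁻¹)

/-- `b = (b_x)_{x ∈ W}` is the Kazhdan–Lusztig family: each `b_x` is self-dual for the bar
involution `d` and `b_x ∈ h_x + Σ_{y < x} v ℤ[v] h_y`, expressed through the coordinates
`h.repr (b x) y ∈ ℤ[v,v⁻¹]` of `b_x` in the standard basis. -/
def IsKLFamily {B W : Type} [Group W] {M : CoxeterMatrix B} (cs : CoxeterSystem M W)
    {H : Type} [Ring H] [Algebra (LaurentPolynomial ℤ) H]
    (h : Module.Basis W (LaurentPolynomial ℤ) H) (d : H →+* H) (b : W → H) : Prop :=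
  ∀ x : W,
    d (b x) = b x ∧
    h.repr (b x) x = 1 ∧
    ∀ y : W, y ≠ x →
      (¬ bruhatLT cs y x → h.repr (b x) y = 0) ∧
      ∀ k : ℤ, k ≤ 0 → (h.repr (b x) y).coeff k = 0

namespace KazhdanLusztig

section Laurent

/-- The part of a Laurent polynomial in strictly positive degrees. -/
noncomputable def posPart (p : ℤ[T;T⁻¹]) : ℤ[T;T⁻¹] :=
  .ofCoeff (p.coeff.filter (0 < ·))

lemma coeff_posPart (p : ℤ[T;T⁻¹]) (k : ℤ) :
    (posPart p).coeff k = if 0 < k then p.coeff k else 0 := by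
  simp [posPart, Finsupp.filter_apply]

@[simp]
lemma posPart_zero : posPart 0 = 0 := by
  ext k
  simp [coeff_posPart]

lemma posPart_sub_invert_posPart {p : ℤ[T;T⁻¹]} (hp : invert p = -p) :
    posPart p - invert (posPart p) = p := by
  ext k
  have hk : p.coeff (-k) = -p.coeff k := by
    rw [← invert_apply, hp]; simp
  simp only [AddMonoidAlgebra.coeff_sub, Finsupp.sub_apply, invert_apply, coeff_posPart, hk]
  rcases lt_trichotomy k 0 with h | rfl | h
  · simp [h, h.not_gt]
  · simp at hk ⊢; lia
  · simp [h, h.not_gt]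

lemma eq_zero_of_invert_eq {p : ℤ[T;T⁻¹]} (hp : invert p = p)
    (hpos : ∀ k ≤ 0, p.coeff k = 0) : p = 0 := by
  ext k
  rcases le_total k 0 with h | h
  · simpa using hpos k h
  · rw [← hp, invert_apply]
    simpa using hpos (-k) (by lia)

end Laurent

section Triangular

variable {ι H : Type*} [Ring H] [Algebra ℤ[T;T⁻¹] H]

lemma map_smul_eq_invert_smul {d : H →+* H}
    (hd : ∀ (n : ℤ) (a : H), d ((T n : ℤ[T;T⁻¹]) • a) = (T (-n) : ℤ[T;T⁻¹]) • d a)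
    (p : ℤ[T;T⁻¹]) (a : H) : d (p • a) = invert p • d a := by
  induction p using LaurentPolynomial.induction_on' with
  | add p q hp hq => simp only [add_smul, map_add, hp, hq]
  | C_mul_T n r => rw [← smul_eq_C_mul, map_zsmul, invert_T, smul_assoc, map_zsmul, hd, smul_assoc]

variable (h : Module.Basis ι ℤ[T;T⁻¹] H) (ℓ : ι → ℕ) (L : Set ι)

/-- The span of the basis vectors indexed by elements of `L` of rank less than `n`. -/
noncomputable def spanLT (n : ℕ) : Submodule ℤ[T;T⁻¹] H :=
  Submodule.span _ (h '' {y | y ∈ L ∧ ℓ y < n})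

variable {h ℓ L}

lemma mem_spanLT {n : ℕ} {a : H} :
    a ∈ spanLT h ℓ L n ↔ ∀ y, h.repr a y ≠ 0 → y ∈ L ∧ ℓ y < n := by
  simp [spanLT, h.mem_span_image, Set.subset_def]

lemma basis_mem_spanLT {n : ℕ} {y : ι} (hy : y ∈ L) (hn : ℓ y < n) : h y ∈ spanLT h ℓ L n :=
  Submodule.subset_span ⟨y, ⟨hy, hn⟩, rfl⟩

lemma spanLT_mono {L' : Set ι} {m n : ℕ} (hL : L ⊆ L') (hmn : m ≤ n) :
    spanLT h ℓ L m ≤ spanLT h ℓ L' n :=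
  Submodule.span_mono (Set.image_mono fun _ hy => ⟨hL hy.1, hy.2.trans_le hmn⟩)

lemma repr_eq_zero_of_mem_spanLT {n : ℕ} {a : H} (ha : a ∈ spanLT h ℓ L n) {y : ι}
    (hy : n ≤ ℓ y) : h.repr a y = 0 := by
  by_contra hne
  exact absurd (mem_spanLT.1 ha y hne).2 hy.not_gt

lemma mem_spanLT_of_succ {n : ℕ} {a : H} (ha : a ∈ spanLT h ℓ L (n + 1))
    (h0 : ∀ y, ℓ y = n → h.repr a y = 0) : a ∈ spanLT h ℓ L n := by
  refine mem_spanLT.2 fun y hy => ?_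
  obtain ⟨hL, hlt⟩ := mem_spanLT.1 ha y hy
  exact ⟨hL, lt_of_le_of_ne (Nat.lt_succ_iff.1 hlt) fun e => hy (h0 y e)⟩

lemma eq_zero_of_mem_spanLT_zero {a : H} (ha : a ∈ spanLT h ℓ L 0) : a = 0 := by
  apply h.repr.injective
  ext1 y
  simpa using repr_eq_zero_of_mem_spanLT ha (Nat.zero_le (ℓ y))

lemma exists_mem_spanLT_univ (h : Module.Basis ι ℤ[T;T⁻¹] H) (ℓ : ι → ℕ) (a : H) :
    ∃ n, a ∈ spanLT h ℓ Set.univ n := by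
  refine ⟨(h.repr a).support.sup ℓ + 1, mem_spanLT.2 fun y hy => ⟨trivial, ?_⟩⟩
  exact Nat.lt_succ_iff.2 (Finset.le_sup (Finsupp.mem_support_iff.2 hy))

variable {d : H →+* H}

/-- A unitriangular semilinear map acts on leading coefficients by `v ↦ v⁻¹`. -/
lemma leading_coeff_map (hd : ∀ (p : ℤ[T;T⁻¹]) (a : H), d (p • a) = invert p • d a)
    (htri : ∀ y ∈ L, d (h y) - h y ∈ spanLT h ℓ L (ℓ y)) {n : ℕ} {a : H}
    (ha : a ∈ spanLT h ℓ L (n + 1)) :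
    d a ∈ spanLT h ℓ L (n + 1) ∧ ∀ y, ℓ y = n → h.repr (d a) y = invert (h.repr a y) := by
  induction ha using Submodule.span_induction with
  | mem a ha =>
    classical
    obtain ⟨x, ⟨hxL, hxn⟩, rfl⟩ := ha
    have hu := htri x hxL
    rw [← sub_add_cancel (d (h x)) (h x)]
    refine ⟨add_mem (spanLT_mono subset_rfl hxn.le hu) (basis_mem_spanLT hxL hxn), fun y hy => ?_⟩
    rw [map_add, Finsupp.add_apply, repr_eq_zero_of_mem_spanLT hu (by lia), zero_add,
      h.repr_self, Finsupp.single_apply]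
    split_ifs <;> simp
  | zero => simp
  | add a b _ _ iha ihb =>
    refine ⟨by simpa using add_mem iha.1 ihb.1, fun y hy => ?_⟩
    simp [iha.2 y hy, ihb.2 y hy]
  | smul p a _ iha =>
    rw [hd]
    refine ⟨Submodule.smul_mem _ _ iha.1, fun y hy => ?_⟩
    simp [iha.2 y hy]

lemma exists_sub_map_eq (hd : ∀ (p : ℤ[T;T⁻¹]) (a : H), d (p • a) = invert p • d a)
    (hdd : ∀ a, d (d a) = a)
    (htri : ∀ y ∈ L, d (h y) - h y ∈ spanLT h ℓ L (ℓ y)) (n : ℕ) {u : H}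
    (hu : u ∈ spanLT h ℓ L n) (hdu : d u = -u) :
    ∃ c ∈ spanLT h ℓ L n, (∀ y, ∀ k ≤ 0, (h.repr c y).coeff k = 0) ∧ c - d c = u := by
  induction n generalizing u with
  | zero => exact ⟨0, zero_mem _, by simp, by simp [eq_zero_of_mem_spanLT_zero hu]⟩
  | succ n ih =>
    classical
    let c₀ : H := h.repr.symm (((h.repr u).mapRange posPart posPart_zero).filter (ℓ · = n))
    have hrepr (y : ι) : h.repr c₀ y = if ℓ y = n then posPart (h.repr u y) else 0 := by
      simp [c₀, Finsupp.filter_apply]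
    have hc₀ : c₀ ∈ spanLT h ℓ L (n + 1) := by
      refine mem_spanLT.2 fun y hy => mem_spanLT.1 hu y fun h0 => hy ?_
      simp [hrepr, h0]
    obtain ⟨hdc₀, hlead⟩ := leading_coeff_map hd htri hc₀
    obtain ⟨c, hc, hpos, hsub⟩ := ih (u := u - (c₀ - d c₀))
      (mem_spanLT_of_succ (sub_mem hu (sub_mem hc₀ hdc₀)) fun y hy => by
        have hy' : invert (h.repr u y) = -h.repr u y := by
          rw [← (leading_coeff_map hd htri hu).2 y hy, hdu]; simp
        simp only [map_sub, Finsupp.sub_apply, hlead y hy, hrepr, if_pos hy]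
        rw [posPart_sub_invert_posPart hy', sub_self])
      (by simp only [map_sub, hdd, hdu]; abel)
    refine ⟨c + c₀, add_mem (spanLT_mono subset_rfl n.le_succ hc) hc₀, fun y k hk => ?_, ?_⟩
    · have : (h.repr c₀ y).coeff k = 0 := by
        rw [hrepr]
        split_ifs <;> simp [coeff_posPart, hk.not_gt]
      simp [hpos y k hk, this]
    · rw [map_add, add_sub_add_comm, hsub, sub_add_cancel]

lemma exists_selfDual (hd : ∀ (p : ℤ[T;T⁻¹]) (a : H), d (p • a) = invert p • d a)
    (hdd : ∀ a, d (d a) = a)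
    (htri : ∀ y ∈ L, d (h y) - h y ∈ spanLT h ℓ L (ℓ y)) {x : ι} (hx : x ∈ L) :
    ∃ b, d b = b ∧ b - h x ∈ spanLT h ℓ L (ℓ x) ∧
      ∀ y, ∀ k ≤ 0, (h.repr (b - h x) y).coeff k = 0 := by
  obtain ⟨c, hc, hpos, hsub⟩ := exists_sub_map_eq hd hdd htri (ℓ x) (htri x hx)
    (by rw [map_sub, hdd, neg_sub])
  refine ⟨h x + c, ?_, by simpa using hc, by simpa using hpos⟩
  rw [map_add, ← sub_eq_zero]
  calc d (h x) + d c - (h x + c) = (d (h x) - h x) - (c - d c) := by abel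
    _ = 0 := by rw [hsub, sub_self]

lemma eq_zero_of_selfDual (hd : ∀ (p : ℤ[T;T⁻¹]) (a : H), d (p • a) = invert p • d a)
    (htri : ∀ y, d (h y) - h y ∈ spanLT h ℓ Set.univ (ℓ y)) {a : H} (hda : d a = a)
    (hpos : ∀ y, ∀ k ≤ 0, (h.repr a y).coeff k = 0) : a = 0 := by
  obtain ⟨n, hn⟩ := exists_mem_spanLT_univ h ℓ a
  induction n with
  | zero => exact eq_zero_of_mem_spanLT_zero hn
  | succ n ih =>
    refine ih (mem_spanLT_of_succ hn fun y hy => eq_zero_of_invert_eq ?_ (hpos y))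
    rw [← (leading_coeff_map hd (fun y _ => htri y) hn).2 y hy, hda]

/-- A family unitriangular with respect to a basis is a basis. -/
lemma exists_basis_of_unitriangular {b : ι → H}
    (hb : ∀ x, b x - h x ∈ spanLT h ℓ Set.univ (ℓ x)) :
    ∃ bb : Module.Basis ι ℤ[T;T⁻¹] H, ⇑bb = b := by
  have hlead {x y : ι} (hxy : ℓ x ≤ ℓ y) : h.repr (b x) y = h.repr (h x) y := by
    have := repr_eq_zero_of_mem_spanLT (hb x) hxy
    rwa [map_sub, Finsupp.sub_apply, sub_eq_zero] at this
  have hli : LinearIndependent ℤ[T;T⁻¹] b := by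
    rw [linearIndependent_iff]
    intro l hl
    have key (n : ℕ) (hn : ∀ x, l x ≠ 0 → ℓ x < n) : l = 0 := by
      induction n with
      | zero => ext1 x; by_contra hx; exact absurd (hn x hx) (Nat.not_lt_zero _)
      | succ n ih =>
        refine ih fun x hx => lt_of_le_of_ne (Nat.lt_succ_iff.1 (hn x hx)) fun hxn => hx ?_
        have h0 : h.repr (Finsupp.linearCombination ℤ[T;T⁻¹] b l) x = 0 := by simp [hl]
        rw [Finsupp.linearCombination_apply, Finsupp.sum, map_sum, Finsupp.finsetSum_apply,
          Finset.sum_eq_single_of_mem x (Finsupp.mem_support_iff.2 hx)] at h0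
        · simpa [hlead le_rfl] using h0
        · intro y hy hyx
          have := hn y (Finsupp.mem_support_iff.1 hy)
          rw [map_smul, Finsupp.smul_apply, hlead (by lia), h.repr_self,
            Finsupp.single_eq_of_ne hyx.symm, smul_zero]
    exact key (l.support.sup ℓ + 1) fun x hx =>
      Nat.lt_succ_iff.2 (Finset.le_sup (Finsupp.mem_support_iff.2 hx))
  have hspan (n : ℕ) : spanLT h ℓ Set.univ n ≤ Submodule.span ℤ[T;T⁻¹] (Set.range b) := by
    induction n with
    | zero => exact fun a ha => by simp [eq_zero_of_mem_spanLT_zero ha]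
    | succ n ih =>
      refine Submodule.span_le.2 ?_
      rintro _ ⟨x, ⟨-, hx⟩, rfl⟩
      rw [← sub_sub_cancel (b x) (h x)]
      exact sub_mem (Submodule.subset_span ⟨x, rfl⟩)
        (ih (spanLT_mono subset_rfl (Nat.lt_succ_iff.1 hx) (hb x)))
  refine ⟨Module.Basis.mk hli fun a _ => ?_, Module.Basis.coe_mk _ _⟩
  obtain ⟨n, hn⟩ := exists_mem_spanLT_univ h ℓ a
  exact hspan n hn

end Triangular

section Hecke

variable {B W : Type} [Group W] {M : CoxeterMatrix B} {cs : CoxeterSystem M W}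
  {H : Type} [Ring H] [Algebra ℤ[T;T⁻¹] H] {h : Module.Basis W ℤ[T;T⁻¹] H}

lemma isReduced_of_cons {i : B} {ω : List B} (hω : cs.IsReduced (i :: ω)) : cs.IsReduced ω := by
  simpa using hω.drop 1

lemma basis_wordProd (hH : IsHeckeAlgebra cs h) {ω : List B} (hω : cs.IsReduced ω) :
    h (cs.wordProd ω) = (ω.map fun i => h (cs.simple i)).prod := by
  induction ω with
  | nil => simp [hH.1]
  | cons i ω ih =>
    have hω' := isReduced_of_cons hω
    have hlt : cs.length (cs.wordProd ω) < cs.length (cs.simple i * cs.wordProd ω) := by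
      rw [← cs.wordProd_cons, hω.eq, hω'.eq]; simp
    rw [List.map_cons, List.prod_cons, ← ih hω', cs.wordProd_cons, (hH.2 i _).1 hlt]

lemma simple_mul_self (hH : IsHeckeAlgebra cs h) (i : B) :
    h (cs.simple i) * h (cs.simple i) = (T (-1) - T 1 : ℤ[T;T⁻¹]) • h (cs.simple i) + 1 := by
  rw [(hH.2 i (cs.simple i)).2 (by simp), cs.simple_mul_simple_self, hH.1]

lemma basis_mul_simple_of_lt (hH : IsHeckeAlgebra cs h) {w : W} {i : B}
    (hlt : cs.length w < cs.length (w * cs.simple i)) :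
    h w * h (cs.simple i) = h (w * cs.simple i) := by
  obtain ⟨ω, hω, rfl⟩ := cs.exists_isReduced w
  have hωi : cs.IsReduced (ω ++ [i]) := by
    have := cs.length_mul_simple (cs.wordProd ω) i
    rw [CoxeterSystem.IsReduced, cs.wordProd_append, cs.wordProd_singleton, List.length_append,
      List.length_singleton, ← hω.eq]
    lia
  rw [← cs.wordProd_singleton, ← cs.wordProd_append, basis_wordProd hH hωi, basis_wordProd hH hω]
  simp

lemma basis_mul_simple_of_gt (hH : IsHeckeAlgebra cs h) {w : W} {i : B}
    (hlt : cs.length (w * cs.simple i) < cs.length w) :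
    h w * h (cs.simple i) = (T (-1) - T 1 : ℤ[T;T⁻¹]) • h w + h (w * cs.simple i) := by
  have hw : h (w * cs.simple i) * h (cs.simple i) = h w := by
    rw [basis_mul_simple_of_lt hH (by simpa using hlt), cs.simple_mul_simple_cancel_right]
  rw [← hw, mul_assoc, simple_mul_self hH, mul_add, mul_one, mul_smul_comm, hw]

/-- The folding property. -/
lemma simple_mul_eq_mul_simple (hH : IsHeckeAlgebra cs h) {w : W} {i j : B}
    (hi : cs.length w < cs.length (cs.simple i * w))
    (hj : cs.length w < cs.length (w * cs.simple j))
    (hij : cs.length (cs.simple i * w * cs.simple j) < cs.length (w * cs.simple j)) :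
    cs.simple i * w = w * cs.simple j := by
  have hlen : cs.length (cs.simple i * w) = cs.length (w * cs.simple j) := by
    have := cs.length_simple_mul w i
    have := cs.length_mul_simple w j
    lia
  have e₁ := (hH.2 i (w * cs.simple j)).2 (by rwa [← mul_assoc])
  have e₂ := basis_mul_simple_of_gt hH (w := cs.simple i * w) (i := j) (by rwa [hlen])
  rw [← basis_mul_simple_of_lt hH hj, ← mul_assoc, (hH.2 i w).1 hi, e₂, mul_assoc,
    add_left_inj, basis_mul_simple_of_lt hH hj] at e₁
  have hv : (T (-1) - T 1 : ℤ[T;T⁻¹]) ≠ 0 := fun h0 => by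
    have := congrArg (fun p : ℤ[T;T⁻¹] => p.coeff 1) h0
    simp at this
  have e₃ := DFunLike.congr_fun (congrArg h.repr e₁) (cs.simple i * w)
  simp only [map_smul, h.repr_self, Finsupp.smul_apply, Finsupp.single_eq_same, smul_eq_mul] at e₃
  by_contra hne
  simp [Ne.symm hne, hv] at e₃

/-- The exchange property. -/
lemma exists_sublist_of_isLeftDescent (hH : IsHeckeAlgebra cs h) {ω : List B}
    (hω : cs.IsReduced ω) {i : B} (hi : cs.IsLeftDescent (cs.wordProd ω) i) :
    ∃ ω' : List B, ω'.Sublist ω ∧ ω'.length + 1 = ω.length ∧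
      cs.wordProd ω' = cs.simple i * cs.wordProd ω := by
  induction ω using List.reverseRecOn with
  | nil => exact absurd hi (by simpa using cs.not_isLeftDescent_one i)
  | append_singleton ω j ih =>
    have hω₀ : cs.IsReduced ω := by simpa using hω.take ω.length
    by_cases hd : cs.IsLeftDescent (cs.wordProd ω) i
    · obtain ⟨ω', hsub, hlen, hprod⟩ := ih hω₀ hd
      exact ⟨ω' ++ [j], hsub.append_right [j], by simp [hlen],
        by simp [cs.wordProd_append, hprod, mul_assoc]⟩
    · refine ⟨ω, List.sublist_append_left _ _, by simp, ?_⟩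
      have hj := hω.eq
      simp only [cs.wordProd_append, cs.wordProd_singleton, List.length_append,
        List.length_singleton, CoxeterSystem.IsLeftDescent, ← mul_assoc] at hj hi ⊢
      rw [simple_mul_eq_mul_simple hH (by rw [cs.not_isLeftDescent_iff.1 hd]; lia)
        (by rw [hj, hω₀.eq]; lia) hi, cs.simple_mul_simple_cancel_right]

/-- Every word contains a reduced word with the same product. -/
lemma exists_isReduced_sublist (hH : IsHeckeAlgebra cs h) (ω : List B) :
    ∃ ω' : List B, ω'.Sublist ω ∧ cs.IsReduced ω' ∧ cs.wordProd ω' = cs.wordProd ω := by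
  induction ω with
  | nil => exact ⟨[], .refl _, by simp [CoxeterSystem.IsReduced], rfl⟩
  | cons i ω ih =>
    obtain ⟨ω₁, hsub, hred, hprod⟩ := ih
    by_cases hd : cs.IsLeftDescent (cs.wordProd ω₁) i
    · obtain ⟨ω₂, hsub₂, hlen, hprod₂⟩ := exists_sublist_of_isLeftDescent hH hred hd
      refine ⟨ω₂, (hsub₂.trans hsub).cons i, ?_, by rw [hprod₂, hprod, cs.wordProd_cons]⟩
      have := cs.isLeftDescent_iff.1 hd
      have := hred.eq
      rw [CoxeterSystem.IsReduced, hprod₂]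
      lia
    · refine ⟨i :: ω₁, hsub.cons_cons i, ?_, by rw [cs.wordProd_cons, cs.wordProd_cons, hprod]⟩
      rw [CoxeterSystem.IsReduced, cs.wordProd_cons, cs.not_isLeftDescent_iff.1 hd, hred.eq,
        List.length_cons]

variable (cs) in
/-- The set of products of subwords of a word. -/
def subwordProds (ω : List B) : Set W :=
  {y | ∃ ω' : List B, ω'.Sublist ω ∧ cs.wordProd ω' = y}

lemma subwordProds_mono {ω ω' : List B} (hsub : ω'.Sublist ω) :
    subwordProds cs ω' ⊆ subwordProds cs ω :=
  fun _ ⟨τ, hτ, hy⟩ => ⟨τ, hτ.trans hsub, hy⟩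

lemma wordProd_mem_subwordProds (ω : List B) : cs.wordProd ω ∈ subwordProds cs ω :=
  ⟨ω, .refl ω, rfl⟩

lemma bruhatLE_of_mem_subwordProds (hH : IsHeckeAlgebra cs h) {ω : List B}
    (hω : cs.IsReduced ω) {y : W} (hy : y ∈ subwordProds cs ω) :
    bruhatLE cs y (cs.wordProd ω) := by
  obtain ⟨τ, hτ, rfl⟩ := hy
  obtain ⟨τ', hτ', hred, hprod⟩ := exists_isReduced_sublist hH τ
  exact ⟨ω, hω, rfl, τ', hτ'.trans hτ, hred, hprod⟩

lemma length_lt_of_bruhatLT {y x : W} (hyx : bruhatLT cs y x) : cs.length y < cs.length x := by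
  obtain ⟨⟨ω, hω, rfl, ω', hsub, hω', rfl⟩, hne⟩ := hyx
  rw [hω.eq, hω'.eq]
  exact lt_of_le_of_ne hsub.length_le fun e => hne (by rw [hsub.eq_of_length e])

variable {d : H →+* H}

lemma map_simple_eq (hH : IsHeckeAlgebra cs h) (hd : IsBarInvolution (fun x : W => h x) d) (i : B) :
    d (h (cs.simple i)) = h (cs.simple i) + (T 1 - T (-1) : ℤ[T;T⁻¹]) • 1 := by
  have hsq := simple_mul_self hH i
  have hneg : (T 1 - T (-1) : ℤ[T;T⁻¹]) = -(T (-1) - T 1) := (neg_sub _ _).symm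
  let u : Hˣ := ⟨h (cs.simple i), h (cs.simple i) + (T 1 - T (-1) : ℤ[T;T⁻¹]) • 1,
    by rw [mul_add, hsq, hneg, mul_smul_comm, mul_one, neg_smul]; abel,
    by rw [add_mul, hsq, hneg, smul_mul_assoc, one_mul, neg_smul]; abel⟩
  rw [hd.2, cs.inv_simple]
  exact Ring.inverse_unit u

lemma map_map_eq_self (hd : IsBarInvolution (fun x : W => h x) d) (hinv : ∀ x : W, IsUnit (h x))
    (a : H) : d (d a) = a := by
  have hsmul := map_smul_eq_invert_smul hd.1
  induction h.mem_span a using Submodule.span_induction with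
  | mem a ha =>
    obtain ⟨x, rfl⟩ := ha
    obtain ⟨u, hu⟩ := hinv x⁻¹
    have hdu : d (u : H) = Ring.inverse (h x) := by rw [hu, hd.2, inv_inv]
    obtain ⟨w, hw⟩ := hinv x
    rw [← hw, Ring.inverse_unit] at hdu
    rw [hd.2]
    dsimp only
    rw [← hu, Ring.inverse_unit, ← hw]
    calc d (↑u⁻¹ : H) = d (↑u⁻¹ : H) * (d (u : H) * w) := by rw [hdu]; simp
      _ = w := by rw [← mul_assoc, ← map_mul]; simp
  | zero => simp
  | add a b _ _ ha hb => rw [map_add, map_add, ha, hb]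
  | smul p a _ ha => rw [hsmul, hsmul, ha, LaurentPolynomial.involutive_invert]

lemma simple_mul_mem_spanLT (hH : IsHeckeAlgebra cs h) {ω : List B} {i : B} {n : ℕ} {a : H}
    (ha : a ∈ spanLT h cs.length (subwordProds cs ω) n) :
    h (cs.simple i) * a ∈ spanLT h cs.length (subwordProds cs (i :: ω)) (n + 1) := by
  induction ha using Submodule.span_induction with
  | mem a ha =>
    obtain ⟨_, ⟨⟨τ, hτ, rfl⟩, hn⟩, rfl⟩ := ha
    have h₁ : h (cs.simple i * cs.wordProd τ) ∈
        spanLT h cs.length (subwordProds cs (i :: ω)) (n + 1) := by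
      refine basis_mem_spanLT ⟨i :: τ, hτ.cons_cons i, cs.wordProd_cons i τ⟩ ?_
      have := cs.length_simple_mul (cs.wordProd τ) i
      lia
    rcases (cs.length_simple_mul_ne (cs.wordProd τ) i).lt_or_gt with hlt | hgt
    · rw [(hH.2 i _).2 hlt]
      exact add_mem (Submodule.smul_mem _ _
        (basis_mem_spanLT ⟨τ, hτ.cons i, rfl⟩ (hn.trans n.lt_succ_self))) h₁
    · rwa [(hH.2 i _).1 hgt]
  | zero => simp
  | add a b _ _ ha hb => rw [mul_add]; exact add_mem ha hb
  | smul p a _ ha => rw [mul_smul_comm]; exact Submodule.smul_mem _ _ ha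

/-- The bar involution is unitriangular with respect to subwords of reduced words. -/
lemma map_basis_wordProd_sub_mem (hH : IsHeckeAlgebra cs h)
    (hd : IsBarInvolution (fun x : W => h x) d) {ω : List B} (hω : cs.IsReduced ω) :
    d (h (cs.wordProd ω)) - h (cs.wordProd ω) ∈
      spanLT h cs.length (subwordProds cs ω) ω.length := by
  induction ω with
  | nil => simp [hH.1]
  | cons i ω ih =>
    have hω' := isReduced_of_cons hω
    have hlt : cs.length (cs.wordProd ω) < cs.length (cs.simple i * cs.wordProd ω) := by
      rw [← cs.wordProd_cons, hω.eq, hω'.eq]; simp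
    have hu := ih hω'
    set u := d (h (cs.wordProd ω)) - h (cs.wordProd ω) with hu_def
    have hdu : d (h (cs.wordProd ω)) = h (cs.wordProd ω) + u := by rw [hu_def]; abel
    have hmono := spanLT_mono (h := h) (ℓ := cs.length) (m := ω.length) (n := ω.length + 1)
      (subwordProds_mono (cs := cs) (List.sublist_cons_self i ω)) (Nat.le_succ _)
    have hx : h (cs.wordProd ω) ∈ spanLT h cs.length (subwordProds cs (i :: ω)) (ω.length + 1) :=
      basis_mem_spanLT ⟨ω, List.sublist_cons_self i ω, rfl⟩ (by rw [hω'.eq]; lia)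
    have hexp : d (h (cs.wordProd (i :: ω))) - h (cs.wordProd (i :: ω)) =
        h (cs.simple i) * u + (T 1 - T (-1) : ℤ[T;T⁻¹]) • (h (cs.wordProd ω) + u) := by
      rw [cs.wordProd_cons, ← (hH.2 i _).1 hlt, map_mul, map_simple_eq hH hd, hdu, add_mul,
        smul_mul_assoc, one_mul, mul_add]
      abel
    rw [hexp]
    exact add_mem (simple_mul_mem_spanLT hH hu) (Submodule.smul_mem _ _ (add_mem hx (hmono hu)))

lemma map_basis_sub_mem (hH : IsHeckeAlgebra cs h)
    (hd : IsBarInvolution (fun x : W => h x) d) (ω : List B) {y : W}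
    (hy : y ∈ subwordProds cs ω) :
    d (h y) - h y ∈ spanLT h cs.length (subwordProds cs ω) (cs.length y) := by
  obtain ⟨τ, hτ, rfl⟩ := hy
  obtain ⟨τ', hτ', hred, hprod⟩ := exists_isReduced_sublist hH τ
  rw [← hprod, hred.eq]
  exact spanLT_mono (subwordProds_mono (hτ'.trans hτ)) le_rfl (map_basis_wordProd_sub_mem hH hd hred)

lemma IsKLFamily.sub_mem_spanLT {b : W → H} (hb : IsKLFamily cs h d b) (x : W) :
    b x - h x ∈ spanLT h cs.length Set.univ (cs.length x) := by
  refine mem_spanLT.2 fun y hy => ⟨trivial, ?_⟩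
  obtain ⟨-, h1, hlow⟩ := hb x
  have hyx : y ≠ x := by
    rintro rfl
    simp [h1] at hy
  refine length_lt_of_bruhatLT (cs := cs) (Classical.not_not.1 fun hnlt => hy ?_)
  simp [(hlow y hyx).1 hnlt, Finsupp.single_eq_of_ne hyx]

lemma exists_isKLFamily (hH : IsHeckeAlgebra cs h) (hd : IsBarInvolution (fun x : W => h x) d)
    (hinv : ∀ x : W, IsUnit (h x)) : ∃ b : W → H, IsKLFamily cs h d b := by
  have hex (x : W) : ∃ b : H, d b = b ∧ h.repr b x = 1 ∧ ∀ y : W, y ≠ x →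
      (¬ bruhatLT cs y x → h.repr b y = 0) ∧ ∀ k : ℤ, k ≤ 0 → (h.repr b y).coeff k = 0 := by
    obtain ⟨ω, hω, rfl⟩ := cs.exists_isReduced x
    obtain ⟨b, hdb, hmem, hpos⟩ := exists_selfDual (map_smul_eq_invert_smul hd.1)
      (map_map_eq_self hd hinv) (fun y => map_basis_sub_mem hH hd ω) (wordProd_mem_subwordProds ω)
    have hrepr {y : W} (hy : y ≠ cs.wordProd ω) :
        h.repr (b - h (cs.wordProd ω)) y = h.repr b y := by
      simp [Finsupp.single_eq_of_ne hy]
    refine ⟨b, hdb, ?_, fun y hy => ⟨fun hnlt => ?_, fun k hk => ?_⟩⟩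
    · have := repr_eq_zero_of_mem_spanLT hmem le_rfl
      simpa [sub_eq_zero] using this
    · by_contra hne
      rw [← hrepr hy] at hne
      exact hnlt ⟨bruhatLE_of_mem_subwordProds hH hω (mem_spanLT.1 hmem y hne).1, hy⟩
    · rw [← hrepr hy]
      exact hpos y k hk
  choose b hb using hex
  exact ⟨b, hb⟩

lemma IsKLFamily.eq (hH : IsHeckeAlgebra cs h) (hd : IsBarInvolution (fun x : W => h x) d)
    {b b' : W → H} (hb : IsKLFamily cs h d b) (hb' : IsKLFamily cs h d b') : b = b' := by
  funext x
  have htri (y : W) : d (h y) - h y ∈ spanLT h cs.length Set.univ (cs.length y) := by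
    obtain ⟨ω, -, rfl⟩ := cs.exists_isReduced y
    exact spanLT_mono (Set.subset_univ _) le_rfl
      (map_basis_sub_mem hH hd ω (wordProd_mem_subwordProds ω))
  obtain ⟨hdb, h1, hlow⟩ := hb x
  obtain ⟨hdb', h1', hlow'⟩ := hb' x
  refine sub_eq_zero.1 (eq_zero_of_selfDual (map_smul_eq_invert_smul hd.1) htri
    (by rw [map_sub, hdb, hdb']) fun y k hk => ?_)
  by_cases hyx : y = x
  · subst hyx
    simp [h1, h1']
  · simp [(hlow y hyx).2 k hk, (hlow' y hyx).2 k hk]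

end Hecke

end KazhdanLusztig

/-- **Existence and uniqueness of the Kazhdan–Lusztig basis.** There is exactly one family
`(b_x)_{x ∈ W}` in the Hecke algebra with `d(b_x) = b_x` and
`b_x ∈ h_x + Σ_{y < x} v ℤ[v] h_y` for all `x`; moreover this family is a basis of `H`
as a `ℤ[v,v⁻¹]`-module. -/
theorem kazhdan_lusztig_basis_exists_unique
    {B W : Type} [Group W] {M : CoxeterMatrix B} (cs : CoxeterSystem M W)
    {H : Type} [Ring H] [Algebra (LaurentPolynomial ℤ) H]
    (h : Module.Basis W (LaurentPolynomial ℤ) H) (hH : IsHeckeAlgebra cs h)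
    (d : H →+* H) (hd : IsBarInvolution (fun x : W => h x) d)
    (hinv : ∀ x : W, IsUnit (h x)) :
    (∃! b : W → H, IsKLFamily cs h d b) ∧
    ∀ b : W → H, IsKLFamily cs h d b →
      ∃ bb : Module.Basis W (LaurentPolynomial ℤ) H, ⇑bb = b := by
  obtain ⟨b, hb⟩ := KazhdanLusztig.exists_isKLFamily hH hd hinv
  exact ⟨⟨b, hb, fun b' hb' => KazhdanLusztig.IsKLFamily.eq hH hd hb' hb⟩,
    fun b hb => KazhdanLusztig.exists_basis_of_unitriangular
      (KazhdanLusztig.IsKLFamily.sub_mem_spanLT hb)⟩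
end

section
/- There exists a unique ring homomorphism d : H → H such that d(vⁿ a) = v⁻ⁿ d(a) for all n ∈ ℤ and a ∈ H, and d(h_x) = (h_{x⁻¹})⁻¹ for all x ∈ W. Moreover d ∘ d is the identity of H. -/
open LaurentPolynomial

/-- To prove an additive property of all vectors it suffices to prove it for multiples of basis
vectors. -/
theorem Module.Basis.induction_smul {ι R V : Type*} [Semiring R] [AddCommMonoid V] [Module R V]
    (b : Module.Basis ι R V) {motive : V → Prop} (zero : motive 0)
    (add : ∀ x y, motive x → motive y → motive (x + y)) (smul : ∀ (r : R) (i : ι), motive (r • b i))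
    (x : V) : motive x := by
  rw [← b.linearCombination_repr x, Finsupp.linearCombination_apply]
  exact Finset.sum_induction _ motive add zero fun i _ => smul _ i

namespace IsHeckeAlgebra

variable {B W : Type} [Group W] {M : CoxeterMatrix B} {cs : CoxeterSystem M W}
  {H : Type} [Ring H] [Algebra (LaurentPolynomial ℤ) H]
  {h : Module.Basis W (LaurentPolynomial ℤ) H}

/-- Standard basis elements multiply as in the group when lengths add up. -/
theorem mul_of_length_mul (hH : IsHeckeAlgebra cs h) (x y : W)
    (hxy : cs.length (x * y) = cs.length x + cs.length y) : h x * h y = h (x * y) := by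
  induction hn : cs.length x generalizing x with
  | zero =>
    obtain rfl := cs.length_eq_zero_iff.mp hn
    rw [hH.1, one_mul, one_mul]
  | succ n ih =>
    have hx : x ≠ 1 := by
      rintro rfl
      simp at hn
    obtain ⟨i, hi⟩ := cs.exists_leftDescent_of_ne_one hx
    rw [cs.isLeftDescent_iff] at hi
    obtain ⟨z, rfl⟩ : ∃ z, x = cs.simple i * z := ⟨cs.simple i * x, by simp⟩
    rw [cs.simple_mul_simple_cancel_left] at hi
    have hle := cs.length_mul_le z y
    have hs := cs.length_simple_mul (z * y) i
    rw [mul_assoc] at hxy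
    rw [← (hH.2 i z).1 (by lia), mul_assoc, ih z (by lia) (by lia),
      (hH.2 i (z * y)).1 (by lia), mul_assoc]

/-- The quadratic relation. -/
theorem simple_mul_self (hH : IsHeckeAlgebra cs h) (i : B) :
    h (cs.simple i) * h (cs.simple i) =
      (T (-1) - T 1 : LaurentPolynomial ℤ) • h (cs.simple i) + 1 := by
  rw [(hH.2 i (cs.simple i)).2 (by simp), cs.simple_mul_simple_self, hH.1]

/-- The quadratic relation for the inverse of a generator. -/
theorem inverse_simple_mul_self (hH : IsHeckeAlgebra cs h) (hinv : ∀ x : W, IsUnit (h x)) (i : B) :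
    Ring.inverse (h (cs.simple i)) * Ring.inverse (h (cs.simple i)) =
      (T 1 - T (-1) : LaurentPolynomial ℤ) • Ring.inverse (h (cs.simple i)) + 1 := by
  have hr := Ring.mul_inverse_cancel _ (hinv (cs.simple i))
  have hq := congrArg (fun a => a * Ring.inverse (h (cs.simple i)) *
    Ring.inverse (h (cs.simple i))) (hH.simple_mul_self i)
  simp only [mul_assoc, hr, mul_one, add_mul, smul_mul_assoc, one_mul] at hq
  rw [← neg_sub, neg_smul, neg_add_eq_sub, eq_sub_iff_add_eq']
  exact hq.symm

/-- The elements `(h_{x⁻¹})⁻¹` multiply as the standard basis when lengths go up. -/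
theorem inverse_simple_mul_of_lt (hH : IsHeckeAlgebra cs h) (hinv : ∀ x : W, IsUnit (h x))
    (i : B) (x : W) (hx : cs.length x < cs.length (cs.simple i * x)) :
    Ring.inverse (h (cs.simple i)) * Ring.inverse (h x⁻¹) =
      Ring.inverse (h (cs.simple i * x)⁻¹) := by
  have hs := cs.length_simple_mul x i
  have hm : h x⁻¹ * h (cs.simple i) = h (cs.simple i * x)⁻¹ := by
    rw [mul_inv_rev, cs.inv_simple]
    apply hH.mul_of_length_mul
    have hl := cs.length_inv (cs.simple i * x)
    rw [mul_inv_rev, cs.inv_simple] at hl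
    rw [hl, cs.length_inv, cs.length_simple]
    lia
  rw [← hm, Ring.inverse_mul (.inl (hinv _))]

/-- The elements `(h_{x⁻¹})⁻¹` satisfy the multiplication rule with `v` and `v⁻¹` exchanged
when lengths go down. -/
theorem inverse_simple_mul_of_gt (hH : IsHeckeAlgebra cs h) (hinv : ∀ x : W, IsUnit (h x))
    (i : B) (x : W) (hx : cs.length (cs.simple i * x) < cs.length x) :
    Ring.inverse (h (cs.simple i)) * Ring.inverse (h x⁻¹) =
      (T 1 - T (-1) : LaurentPolynomial ℤ) • Ring.inverse (h x⁻¹) +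
        Ring.inverse (h (cs.simple i * x)⁻¹) := by
  have hup := hH.inverse_simple_mul_of_lt hinv i (cs.simple i * x) (by simpa using hx)
  rw [cs.simple_mul_simple_cancel_left] at hup
  rw [← hup, ← mul_assoc, hH.inverse_simple_mul_self hinv, add_mul, smul_mul_assoc, one_mul]

end IsHeckeAlgebra

/-- The additive map sending `c • h_x` to `c̄ • (h_{x⁻¹})⁻¹`, where `c̄` is `c` with `v` and `v⁻¹`
exchanged. -/
noncomputable def barAddHom {W H : Type} [Group W] [Ring H] [Algebra (LaurentPolynomial ℤ) H]
    (h : Module.Basis W (LaurentPolynomial ℤ) H) : H →+ H :=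
  (Finsupp.liftAddHom fun x =>
    ((smulAddHom (LaurentPolynomial ℤ) H).flip (Ring.inverse (h x⁻¹))).comp
      (invert (R := ℤ) : LaurentPolynomial ℤ →+ LaurentPolynomial ℤ)).comp
    (h.repr : H →+ W →₀ LaurentPolynomial ℤ)

section Bar

variable {B W : Type} [Group W] {M : CoxeterMatrix B} {cs : CoxeterSystem M W}
  {H : Type} [Ring H] [Algebra (LaurentPolynomial ℤ) H]
  {h : Module.Basis W (LaurentPolynomial ℤ) H}

theorem barAddHom_smul_basis (h : Module.Basis W (LaurentPolynomial ℤ) H)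
    (c : LaurentPolynomial ℤ) (x : W) :
    barAddHom h (c • h x) = invert c • Ring.inverse (h x⁻¹) := by
  simp [barAddHom]

theorem barAddHom_basis (h : Module.Basis W (LaurentPolynomial ℤ) H) (x : W) :
    barAddHom h (h x) = Ring.inverse (h x⁻¹) := by
  simp [barAddHom]

theorem barAddHom_smul (h : Module.Basis W (LaurentPolynomial ℤ) H) (c : LaurentPolynomial ℤ)
    (a : H) : barAddHom h (c • a) = invert c • barAddHom h a := by
  induction a using h.induction_smul with
  | zero => simp
  | add a b ha hb => simp only [smul_add, map_add, ha, hb]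
  | smul r x =>
    rw [smul_smul, barAddHom_smul_basis, barAddHom_smul_basis, map_mul, mul_smul]

theorem barAddHom_simple_mul (hH : IsHeckeAlgebra cs h) (hinv : ∀ x : W, IsUnit (h x)) (i : B)
    (a : H) : barAddHom h (h (cs.simple i) * a) =
      barAddHom h (h (cs.simple i)) * barAddHom h a := by
  induction a using h.induction_smul with
  | zero => simp
  | add a b ha hb => simp only [mul_add, map_add, ha, hb]
  | smul r x =>
    rw [mul_smul_comm, barAddHom_smul, barAddHom_smul, mul_smul_comm]
    congr 1
    rw [barAddHom_basis, barAddHom_basis, cs.inv_simple]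
    rcases (cs.length_simple_mul_ne x i).lt_or_gt with hx | hx
    · rw [(hH.2 i x).2 hx, map_add, barAddHom_smul, barAddHom_basis, barAddHom_basis,
        hH.inverse_simple_mul_of_gt hinv i x hx]
      simp
    · rw [(hH.2 i x).1 hx, barAddHom_basis, hH.inverse_simple_mul_of_lt hinv i x hx]

theorem barAddHom_one (hH : IsHeckeAlgebra cs h) : barAddHom h 1 = 1 := by
  rw [← hH.1, barAddHom_basis, inv_one, hH.1, Ring.inverse_one]

theorem barAddHom_basis_mul (hH : IsHeckeAlgebra cs h) (hinv : ∀ x : W, IsUnit (h x)) (x : W)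
    (a : H) : barAddHom h (h x * a) = barAddHom h (h x) * barAddHom h a := by
  induction hn : cs.length x generalizing x a with
  | zero =>
    obtain rfl := cs.length_eq_zero_iff.mp hn
    rw [hH.1, one_mul, barAddHom_one hH, one_mul]
  | succ n ih =>
    have hx : x ≠ 1 := by
      rintro rfl
      simp at hn
    obtain ⟨i, hi⟩ := cs.exists_leftDescent_of_ne_one hx
    rw [cs.isLeftDescent_iff] at hi
    obtain ⟨z, rfl⟩ : ∃ z, x = cs.simple i * z := ⟨cs.simple i * x, by simp⟩
    rw [cs.simple_mul_simple_cancel_left] at hi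
    rw [← (hH.2 i z).1 (by lia), mul_assoc, barAddHom_simple_mul hH hinv,
      ih z a (by lia), barAddHom_simple_mul hH hinv, mul_assoc]

theorem barAddHom_mul (hH : IsHeckeAlgebra cs h) (hinv : ∀ x : W, IsUnit (h x)) (a b : H) :
    barAddHom h (a * b) = barAddHom h a * barAddHom h b := by
  induction a using h.induction_smul with
  | zero => simp
  | add a c ha hc => simp only [add_mul, map_add, ha, hc]
  | smul r x =>
    rw [smul_mul_assoc, barAddHom_smul, barAddHom_smul, smul_mul_assoc,
      barAddHom_basis_mul hH hinv]

/-- An additive map inverting the powers of `v` is semilinear over `v ↦ v⁻¹`. -/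
theorem map_smul_of_map_T_smul {H : Type} [Ring H] [Algebra (LaurentPolynomial ℤ) H] (d : H →+ H)
    (hd : ∀ (n : ℤ) (a : H),
      d ((T n : LaurentPolynomial ℤ) • a) = (T (-n) : LaurentPolynomial ℤ) • d a)
    (c : LaurentPolynomial ℤ) (a : H) : d (c • a) = invert c • d a := by
  induction c using LaurentPolynomial.induction_on' with
  | add p q hp hq => simp only [add_smul, map_add, hp, hq]
  | C_mul_T n m =>
    have hC : (C m : LaurentPolynomial ℤ) = (m : LaurentPolynomial ℤ) := by simp
    rw [map_mul, invert_T, invert_C, mul_smul, mul_smul, hC, Int.cast_smul_eq_zsmul,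
      Int.cast_smul_eq_zsmul, map_zsmul, hd]

end Bar

/-- **Existence and uniqueness of the bar involution.** There is exactly one ring
homomorphism `d : H → H` with `d(vⁿ a) = v⁻ⁿ d(a)` for all `n ∈ ℤ`, `a ∈ H`, and
`d(h_x) = (h_{x⁻¹})⁻¹` for all `x ∈ W`; moreover `d ∘ d` is the identity of `H`. -/
theorem bar_involution_exists_unique
    {B W : Type} [Group W] {M : CoxeterMatrix B} (cs : CoxeterSystem M W)
    {H : Type} [Ring H] [Algebra (LaurentPolynomial ℤ) H]
    (h : Module.Basis W (LaurentPolynomial ℤ) H) (hH : IsHeckeAlgebra cs h)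
    (hinv : ∀ x : W, IsUnit (h x)) :
    (∃! d : H →+* H,
      (∀ (n : ℤ) (a : H),
        d ((T n : LaurentPolynomial ℤ) • a) = (T (-n) : LaurentPolynomial ℤ) • d a) ∧
      ∀ x : W, d (h x) = Ring.inverse (h x⁻¹)) ∧
    ∀ d : H →+* H,
      ((∀ (n : ℤ) (a : H),
        d ((T n : LaurentPolynomial ℤ) • a) = (T (-n) : LaurentPolynomial ℤ) • d a) ∧
      ∀ x : W, d (h x) = Ring.inverse (h x⁻¹)) →
      ∀ a : H, d (d a) = a := by
  have hsemi (d : H →+* H) (hd : ∀ (n : ℤ) (a : H),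
      d ((T n : LaurentPolynomial ℤ) • a) = (T (-n) : LaurentPolynomial ℤ) • d a)
      (c : LaurentPolynomial ℤ) (a : H) : d (c • a) = invert c • d a :=
    map_smul_of_map_T_smul (d : H →+ H) hd c a
  refine ⟨⟨{ barAddHom h with
      map_one' := barAddHom_one hH
      map_mul' := barAddHom_mul hH hinv }, ⟨fun n a => ?_, barAddHom_basis h⟩, ?_⟩, ?_⟩
  · exact (barAddHom_smul h (T n) a).trans (by rw [invert_T]; rfl)
  · rintro d ⟨hd, hdx⟩
    ext a
    change d a = barAddHom h a
    induction a using h.induction_smul with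
    | zero => simp
    | add a b ha hb => simp only [map_add, ha, hb]
    | smul r x => rw [hsemi d hd, barAddHom_smul, hdx, barAddHom_basis]
  · rintro d ⟨hd, hdx⟩ a
    induction a using h.induction_smul with
    | zero => simp
    | add a b ha hb => simp only [map_add, ha, hb]
    | smul r x =>
      have hone : d (Ring.inverse (h x⁻¹)) * Ring.inverse (h x) = 1 := by
        have hx := hdx x⁻¹
        rw [inv_inv] at hx
        rw [← hx, ← map_mul, Ring.inverse_mul_cancel _ (hinv _), map_one]
      have hxx : d (Ring.inverse (h x⁻¹)) = h x := by
        rw [← mul_one (d _), ← Ring.inverse_mul_cancel _ (hinv x), ← mul_assoc, hone, one_mul]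
      rw [hsemi d hd, hsemi d hd, hdx, hxx, involutive_invert]
end
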